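/- arXiv:2111.03034 — 2 statements merged into one kernel-verified Lean document; each statement's English description precedes it below -/
import Mathlib

section
/- Let μ be a distribution over {-1,+1}^V with n = |V|, θ ∈ (0,1), π = μ^(θ), and f: {-1,+1}^V → ℝ_{≥0}. With H_f(ℓ,k) = (1/binom(nk,ℓ)) Σ_{S ⊆ V×[k], |S| = ℓ} μ_k[Ent_S[f^k]], it holds that lim_{k→∞} H_f(⌈θnk⌉, k) = (Z_π/θ^n) · E_{R∼Bin(V,1−θ)}[π_R(𝟙_R) · Ent_{π^{𝟙_R}}[f]], with the convention that a term with π_R(𝟙_R) = 0 equals 0. -/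
open Classical Finset

noncomputable section

namespace PaperIsing

/-- A configuration assigns to each vertex a spin; `true` encodes `+1`, `false` encodes `-1`. -/
abbrev Conf (V : Type*) := V → Bool

variable {V : Type*} [Fintype V] [DecidableEq V]

/-- `μ` is a probability distribution on the finite type `A`. -/
def IsDist {A : Type*} [Fintype A] (μ : A → ℝ) : Prop :=
  (∀ a, 0 ≤ μ a) ∧ ∑ a, μ a = 1

/-- Entropy functional `Ent_μ[f] = E_μ[f log f] − E_μ[f] log E_μ[f]`
(the convention `0 log 0 = 0` holds since `Real.log 0 = 0`). -/
def entOf {A : Type*} [Fintype A] (μ f : A → ℝ) : ℝ :=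
  (∑ a, μ a * (f a * Real.log (f a))) - (∑ a, μ a * f a) * Real.log (∑ a, μ a * f a)

/-- KL divergence `KL(ν‖μ)`. -/
def klDivF {A : Type*} [Fintype A] (ν μ : A → ℝ) : ℝ :=
  ∑ a, ν a * Real.log (ν a / μ a)

/-- The covariance of `f` and `log f` with respect to `ν`. -/
def ment {A : Type*} [Fintype A] (ν f : A → ℝ) : ℝ :=
  (1/2) * ∑ σ : A, ∑ τ : A, ν σ * ν τ * (f σ - f τ) * (Real.log (f σ) - Real.log (f τ))

/-- Total variation distance between two distributions on a finite type. -/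
def tvDist {A : Type*} [Fintype A] (p q : A → ℝ) : ℝ :=
  (1/2) * ∑ a, |p a - q a|

/-- The set of `+1` vertices of a configuration. -/
def plusSet (σ : Conf V) : Finset V := Finset.univ.filter (fun v => σ v = true)

/-- `‖σ‖₊`, the number of `+1` spins. -/
def plusCount (σ : Conf V) : ℕ := (plusSet σ).card

/-- Marginal probability, under `μ`, that the configuration agrees with `τ` on `Λ`. -/
def margin (μ : Conf V → ℝ) (Λ : Finset V) (τ : Conf V) : ℝ :=
  ∑ σ : Conf V, if ∀ v ∈ Λ, σ v = τ v then μ σ else 0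

/-- `μ` conditioned on agreeing with `τ` on `Λ`. -/
def condDist (μ : Conf V → ℝ) (Λ : Finset V) (τ : Conf V) : Conf V → ℝ :=
  fun σ => if ∀ v ∈ Λ, σ v = τ v then μ σ / margin μ Λ τ else 0

/-- Transition matrix of the Glauber dynamics for `μ`:
pick `v` uniformly, resample the spin at `v` from the conditional marginal. -/
def glauber (μ : Conf V → ℝ) (σ τ : Conf V) : ℝ :=
  (Fintype.card V : ℝ)⁻¹ * ∑ v : V, condDist μ (Finset.univ.erase v) σ τ

/-- Dirichlet form `E_P(f, log f) = ⟨f, (I−P) log f⟩_μ` for the Glauber dynamics `P` on `μ`. -/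
def dirichletLog (μ f : Conf V → ℝ) : ℝ :=
  ∑ σ : Conf V, μ σ * f σ * (Real.log (f σ) - ∑ τ : Conf V, glauber μ σ τ * Real.log (f τ))

/-- Modified log-Sobolev constant of the Glauber dynamics on `μ`. -/
def mlsConst (μ : Conf V → ℝ) : ℝ :=
  sInf {r : ℝ | ∃ f : Conf V → ℝ, (∀ σ, 0 ≤ f σ) ∧ entOf μ f ≠ 0 ∧
    r = dirichletLog μ f / entOf μ f}

/-- Modified log-Sobolev constant under the worst pinning. -/
def mlsMin (μ : Conf V → ℝ) : ℝ :=
  sInf {r : ℝ | ∃ (Λ : Finset V) (τ : Conf V), 0 < margin μ Λ τ ∧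
    r = mlsConst (condDist μ Λ τ)}

/-- Imposing local fields `lam` on `μ`: `μ^(λ)(σ) ∝ μ(σ) ∏_{v : σ_v = +1} λ_v`. -/
def magnetize (μ : Conf V → ℝ) (lam : V → ℝ) : Conf V → ℝ :=
  fun σ => (μ σ * ∏ v : V, if σ v then lam v else 1) /
    (∑ τ : Conf V, μ τ * ∏ v : V, if τ v then lam v else 1)

/-- Imposing the constant local field `θ`. -/
def magnetizeC (μ : Conf V → ℝ) (θ : ℝ) : Conf V → ℝ :=
  magnetize μ (fun _ => θ)

/-- `Z_π = ∑_σ μ(σ) θ^{‖σ‖₊}`. -/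
def Zmag (μ : Conf V → ℝ) (θ : ℝ) : ℝ :=
  ∑ σ : Conf V, μ σ * θ ^ plusCount σ

/-- `Pr_μ[σ_v = +1 ∣ σ_u = b]`. -/
def condPlusProb (μ : Conf V → ℝ) (u : V) (b : Bool) (v : V) : ℝ :=
  (∑ σ : Conf V, if σ u = b ∧ σ v = true then μ σ else 0) /
  (∑ σ : Conf V, if σ u = b then μ σ else 0)

/-- Signed influence matrix `Ψ^inf_μ(u,v)`. -/
def infl (μ : Conf V → ℝ) (u v : V) : ℝ :=
  if u ≠ v ∧ 0 < (∑ σ : Conf V, if σ u = true then μ σ else 0) ∧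
      0 < (∑ σ : Conf V, if σ u = false then μ σ else 0)
  then condPlusProb μ u true v - condPlusProb μ u false v
  else 0

/-- `μ` is `η`-spectrally independent in `∞`-norm. -/
def SIinf (μ : Conf V → ℝ) (η : ℝ) : Prop :=
  ∀ u : V, ∑ v : V, |infl μ u v| ≤ η

/-- `μ` is `η`-spectrally independent in `∞`-norm with all fields. -/
def SIinfAllFields (μ : Conf V → ℝ) (η : ℝ) : Prop :=
  ∀ lam : V → ℝ, (∀ v, 0 < lam v) → SIinf (magnetize μ lam) η

/-- The projection `σ ↦ σ*` from configurations on `V × [k]` to configurations on `V`. -/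
def kstar {k : ℕ} (τ : Conf (V × Fin k)) : Conf V :=
  fun v => decide (∃ i : Fin k, τ (v, i) = true)

/-- The `k`-transformation `μ_k = Trans(μ, k)` of `μ`. -/
def ktrans (μ : Conf V → ℝ) (k : ℕ) : Conf (V × Fin k) → ℝ :=
  fun τ =>
    if ∀ v : V, (Finset.univ.filter (fun i : Fin k => τ (v, i) = true)).card ≤ 1
    then μ (kstar τ) * ((k : ℝ)⁻¹) ^ plusCount (kstar τ)
    else 0

/-- Probability of the subset `R` under `Bin(V, 1−θ)`. -/
def binWeight (θ : ℝ) (R : Finset V) : ℝ :=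
  (1 - θ) ^ R.card * θ ^ (Fintype.card V - R.card)

/-- The term `π_R(𝟙_R) ⬝ Ent_{π^{𝟙_R}}[f]` with `π = μ^(θ)`
(when `π_R(𝟙_R) = 0` this product is `0`, matching the convention). -/
def mbfTerm (μ : Conf V → ℝ) (θ : ℝ) (f : Conf V → ℝ) (R : Finset V) : ℝ :=
  margin (magnetizeC μ θ) R (fun _ => true) *
    entOf (condDist (magnetizeC μ θ) R (fun _ => true)) f

/-- `θ`-magnetized block factorization of entropy with parameter `C`. -/
def MBF (μ : Conf V → ℝ) (θ C : ℝ) : Prop :=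
  ∀ f : Conf V → ℝ, (∀ σ, 0 ≤ f σ) →
    entOf μ f ≤ C * (Zmag μ θ / θ ^ (Fintype.card V)) *
      ∑ R : Finset V, binWeight θ R * mbfTerm μ θ f R

/-- `ν[Ent_S[f]] = ∑_{σ ∈ Ω(ν_{W∖S})} ν_{W∖S}(σ) Ent_{ν^σ}[f]`, with canonical
representatives `χ` vanishing on `S`. -/
def avgEnt {W : Type*} [Fintype W] [DecidableEq W]
    (ν : Conf W → ℝ) (S : Finset W) (f : Conf W → ℝ) : ℝ :=
  ∑ χ : Conf W, if ∀ v ∈ S, χ v = false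
    then margin ν (Finset.univ \ S) χ * entOf (condDist ν (Finset.univ \ S) χ) f
    else 0

/-- `ℓ`-uniform block factorization of entropy with parameter `C`. -/
def UBF {W : Type*} [Fintype W] [DecidableEq W]
    (ν : Conf W → ℝ) (ℓ : ℕ) (C : ℝ) : Prop :=
  ∀ f : Conf W → ℝ, (∀ σ, 0 ≤ f σ) →
    entOf ν f ≤ (C / (Nat.choose (Fintype.card W) ℓ : ℝ)) *
      ∑ S ∈ Finset.powersetCard ℓ (Finset.univ : Finset W), avgEnt ν S f

/-- The down walk applied to a distribution: `(ν D_{k→j})(β) = Σ_{α ⊇ β} ν(α)/C(k,j)`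
for `|β| = j`. -/
def downDist {U : Type*} [Fintype U] [DecidableEq U]
    (ν : Finset U → ℝ) (k j : ℕ) : Finset U → ℝ :=
  fun β => if β.card = j
    then (∑ α : Finset U, if β ⊆ α ∧ α.card = k then ν α else 0) / (Nat.choose k j : ℝ)
    else 0

/-- The up walk applied to a function:
`(U_{j→k} f)(α) = (Σ_{β ⊇ α} μ(β) f(β)) / (Σ_{γ ⊇ α} μ(γ))` for `μ` supported on size-`k` sets. -/
def upFun {U : Type*} [Fintype U] [DecidableEq U]
    (μ f : Finset U → ℝ) : Finset U → ℝ :=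
  fun α => (∑ β : Finset U, if α ⊆ β then μ β * f β else 0) /
    (∑ γ : Finset U, if α ⊆ γ then μ γ else 0)

/-- The multivariate hypergeometric distribution `HG(V, k, ℓ)`. -/
def hyperGeo (V : Type*) [Fintype V] (k ℓ : ℕ) (a : V → ℕ) : ℝ :=
  if ∑ v, a v = ℓ
  then (∏ v, (Nat.choose k (a v) : ℝ)) / (Nat.choose (k * Fintype.card V) ℓ : ℝ)
  else 0

/-- The flipped distribution `flip(μ, χ)(σ) = μ(σ ⊙ χ)`, where `(σ ⊙ χ)_v = σ_v χ_v`. -/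
def flipDist (μ : Conf V → ℝ) (χ : Conf V) : Conf V → ℝ :=
  fun σ => μ (fun v => σ v == χ v)

/-- The number of monochromatic edges of `G` under `σ`. -/
def monoCount (G : SimpleGraph V) (σ : Conf V) : ℕ :=
  (Finset.univ.filter (fun e : Sym2 V =>
    e ∈ G.edgeSet ∧ ∀ a ∈ e, ∀ b ∈ e, σ a = σ b)).card

/-- The Gibbs distribution of the Ising model `(G, β, λ)`. -/
def isingGibbs (G : SimpleGraph V) (β : ℝ) (lam : V → ℝ) : Conf V → ℝ :=
  fun σ => (β ^ monoCount G σ * ∏ v : V, if σ v then lam v else 1) /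
    (∑ τ : Conf V, β ^ monoCount G τ * ∏ v : V, if τ v then lam v else 1)

/-- Distribution of the Glauber dynamics on `μ` after `t` steps, started from initial
distribution `ν`. -/
def chainDist (μ ν : Conf V → ℝ) : ℕ → Conf V → ℝ
  | 0 => ν
  | (t+1) => fun τ => ∑ σ : Conf V, chainDist μ ν t σ * glauber μ σ τ

/-- `‖Ψ^inf_μ‖_∞ = max_u Σ_v |Ψ^inf_μ(u,v)|`. -/
def psiNorm [Nonempty V] (μ : Conf V → ℝ) : ℝ :=
  Finset.univ.sup' Finset.univ_nonempty (fun u => ∑ v : V, |infl μ u v|)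

end PaperIsing

open PaperIsing

/-- weighted entropy -/
def Gw {A : Type*} [Fintype A] (w f : A → ℝ) : ℝ :=
  (∑ a, w a * (f a * Real.log (f a))) -
    (∑ a, w a) * (((∑ a, w a * f a) / ∑ a, w a) * Real.log ((∑ a, w a * f a) / ∑ a, w a))

lemma Gw_zero {A : Type*} [Fintype A] (w f : A → ℝ) (h : ∀ a, w a = 0) : Gw w f = 0 := by
  simp [Gw, h]

lemma Gw_smul {A : Type*} [Fintype A] (c : ℝ) (hc : c ≠ 0) (w f : A → ℝ) :
    Gw (fun a => c * w a) f = c * Gw w f := by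
  unfold Gw
  simp only [mul_assoc, ← Finset.mul_sum]
  rw [mul_div_mul_left _ _ hc]
  ring

lemma margin_ent {W : Type*} [Fintype W] [DecidableEq W] (ν : Conf W → ℝ) (hν : ∀ σ, 0 ≤ ν σ)
    (Λ : Finset W) (τ : Conf W) (f : Conf W → ℝ) :
    margin ν Λ τ * entOf (condDist ν Λ τ) f =
      Gw (fun σ => if ∀ v ∈ Λ, σ v = τ v then ν σ else 0) f := by
  by_cases hm : margin ν Λ τ = 0
  · rw [hm, zero_mul, Gw_zero]
    intro a
    unfold margin at hm
    rw [Finset.sum_eq_zero_iff_of_nonneg] at hm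
    · exact hm a (Finset.mem_univ _)
    · intro i _
      split_ifs
      · exact hν i
      · exact le_rfl
  · have h1 : condDist ν Λ τ =
        fun σ => (if ∀ v ∈ Λ, σ v = τ v then ν σ else 0) / margin ν Λ τ := by
      funext σ
      simp only [condDist]
      split_ifs <;> simp
    rw [h1]
    unfold entOf Gw
    have h2 : (∑ σ, if ∀ v ∈ Λ, σ v = τ v then ν σ else 0) = margin ν Λ τ := rfl
    rw [h2]
    simp only [div_mul_eq_mul_div, ← Finset.sum_div]
    field_simp

lemma Gw_push {A B : Type*} [Fintype A] [Fintype B] (p : A → B) (w : A → ℝ) (w' : B → ℝ)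
    (h : ∀ g : B → ℝ, ∑ a, w a * g (p a) = ∑ b, w' b * g b) (f : B → ℝ) :
    Gw w (fun a => f (p a)) = Gw w' f := by
  unfold Gw
  have h0 := h (fun _ => 1)
  simp only [mul_one] at h0
  rw [h (fun b => f b * Real.log (f b)), h f, h0]

/-- second moment -/
lemma pair_count {W : Type*} [Fintype W] [DecidableEq W] (ℓ : ℕ) (p q : W) (hpq : p ≠ q) :
    (((powersetCard ℓ (univ : Finset W)).filter (fun S => p ∈ S ∧ q ∈ S)).card : ℝ) ≤
      (Nat.choose (Fintype.card W) ℓ : ℝ) * ((ℓ : ℝ) / Fintype.card W) ^ 2 := by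
  have hset : (powersetCard ℓ (univ : Finset W)).filter (fun S => p ∈ S ∧ q ∈ S) =
      (powersetCard ℓ (univ : Finset W)).filter (fun S => ({p, q} : Finset W) ⊆ S) := by
    ext S; simp [Finset.insert_subset_iff]
  have hc : ({p, q} : Finset W).card = 2 := Finset.card_pair hpq
  rw [hset]
  rcases Nat.lt_or_ge ℓ 2 with hl | hl
  · have : (powersetCard ℓ (univ : Finset W)).filter (fun S => ({p, q} : Finset W) ⊆ S) = ∅ := by
      ext S
      simp only [mem_filter, mem_powersetCard, subset_univ, true_and, notMem_empty, iff_false]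
      rintro ⟨h1, h2⟩
      have := Finset.card_le_card h2
      omega
    rw [this]
    simp only [card_empty, Nat.cast_zero]; positivity
  · rw [Finset.card_filter_powersetCard_subset _ _ _ (subset_univ _) (by omega), hc, Finset.card_univ]
    have hN : 2 ≤ Fintype.card W := by
      rw [← hc]; exact Finset.card_le_univ _
    obtain ⟨N, hN⟩ := Nat.exists_eq_add_of_le hN
    obtain ⟨l, rfl⟩ := Nat.exists_eq_add_of_le hl
    rw [hN]
    rcases Nat.lt_or_ge N l with hlt | hle
    · rw [show 2 + N - 2 = N by omega, show 2 + l - 2 = l by omega, Nat.choose_eq_zero_of_lt hlt]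
      simp only [Nat.cast_zero]; positivity
    have e1 := Nat.add_one_mul_choose_eq N l
    have e2 := Nat.add_one_mul_choose_eq (N+1) (l+1)
    rw [show 2 + N - 2 = N by omega, show 2 + l - 2 = l by omega, show 2 + N = N + 1 + 1 by omega,
      show 2 + l = l + 1 + 1 by omega]
    have e1' : ((N:ℝ) + 1) * (N.choose l) = ((N+1).choose (l+1)) * ((l:ℝ)+1) := by exact_mod_cast e1
    have e2' : ((N:ℝ) + 1 + 1) * ((N+1).choose (l+1)) = ((N+1+1).choose (l+1+1)) * ((l:ℝ)+1+1) := by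
      exact_mod_cast e2
    have hle' : (l:ℝ) ≤ N := by exact_mod_cast hle
    set C := (((N+1+1).choose (l+1+1) : ℕ) : ℝ)
    have hC : 0 ≤ C := Nat.cast_nonneg _
    have e3 : ((N.choose l : ℕ) : ℝ) = C * (((l:ℝ)+1+1)/((N:ℝ)+1+1)) * (((l:ℝ)+1)/((N:ℝ)+1)) := by
      field_simp
      nlinarith
    rw [e3]
    push_cast
    rw [sq, ← mul_assoc]
    apply mul_le_mul_of_nonneg_left
    · rw [div_le_div_iff₀ (by positivity) (by positivity)]
      nlinarith
    · positivity

lemma single_count {W : Type*} [Fintype W] [DecidableEq W] (ℓ : ℕ) (p : W) :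
    (((powersetCard ℓ (univ : Finset W)).filter (fun S => p ∈ S)).card : ℝ) =
      (Nat.choose (Fintype.card W) ℓ : ℝ) * ((ℓ : ℝ) / Fintype.card W) := by
  have hset : (powersetCard ℓ (univ : Finset W)).filter (fun S => p ∈ S) =
      (powersetCard ℓ (univ : Finset W)).filter (fun S => ({p} : Finset W) ⊆ S) := by
    ext S; simp
  rw [hset]
  rcases Nat.lt_or_ge ℓ 1 with hl | hl
  · have : ℓ = 0 := by omega
    subst this
    simp [Finset.filter_singleton]
  · rw [Finset.card_filter_powersetCard_subset _ _ _ (subset_univ _) (by simpa using hl), card_singleton, Finset.card_univ]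
    have hN : 1 ≤ Fintype.card W := Fintype.card_pos_iff.mpr ⟨p⟩
    obtain ⟨N, hN⟩ := Nat.exists_eq_add_of_le hN
    obtain ⟨l, rfl⟩ := Nat.exists_eq_add_of_le hl
    rw [hN]
    have e1 := Nat.add_one_mul_choose_eq N l
    rw [show 1 + N - 1 = N by omega, show 1 + l - 1 = l by omega, show 1 + N = N + 1 by omega,
      show 1 + l = l + 1 by omega]
    have e1' : ((N:ℝ) + 1) * (N.choose l) = ((N+1).choose (l+1)) * ((l:ℝ)+1) := by exact_mod_cast e1
    push_cast
    field_simp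
    linarith

lemma second_moment {W : Type*} [Fintype W] [DecidableEq W] (ℓ : ℕ) (T : Finset W) (hT : 0 < T.card)
    (θ : ℝ) :
    ∑ S ∈ powersetCard ℓ (univ : Finset W), (((S ∩ T).card : ℝ) / T.card - θ) ^ 2 ≤
      (Nat.choose (Fintype.card W) ℓ : ℝ) * (1 / (T.card : ℝ) + ((ℓ : ℝ) / Fintype.card W - θ) ^ 2) := by
  set P := powersetCard ℓ (univ : Finset W) with hP
  set C := (Nat.choose (Fintype.card W) ℓ : ℝ) with hC
  set r := (ℓ : ℝ) / Fintype.card W with hr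
  have hPC : (P.card : ℝ) = C := by
    rw [hP, Finset.card_powersetCard, Finset.card_univ]
  have hk : (0:ℝ) < T.card := by exact_mod_cast hT
  have hC0 : 0 ≤ C := Nat.cast_nonneg _
  have hcard : ∀ S : Finset W, ((S ∩ T).card : ℝ) = ∑ p ∈ T, if p ∈ S then (1:ℝ) else 0 := by
    intro S
    rw [Finset.sum_boole, Finset.filter_mem_eq_inter, Finset.inter_comm]
  have m1 : ∑ S ∈ P, ((S ∩ T).card : ℝ) = T.card * (C * r) := by
    simp_rw [hcard]
    rw [Finset.sum_comm]
    simp_rw [Finset.sum_boole]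
    rw [Finset.sum_congr rfl (fun p _ => single_count ℓ p)]
    simp [← hC, ← hr]
  have m2 : ∑ S ∈ P, ((S ∩ T).card : ℝ) ^ 2 ≤ T.card * C + T.card * T.card * (C * r ^ 2) := by
    have : ∑ S ∈ P, ((S ∩ T).card : ℝ) ^ 2 = ∑ p ∈ T, ∑ q ∈ T, ((P.filter (fun S => p ∈ S ∧ q ∈ S)).card : ℝ) := by
      simp_rw [hcard, sq, Finset.sum_mul_sum]
      rw [Finset.sum_comm]
      refine Finset.sum_congr rfl fun p _ => ?_
      rw [Finset.sum_comm]
      refine Finset.sum_congr rfl fun q _ => ?_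
      rw [← Finset.sum_boole]
      refine Finset.sum_congr rfl fun S _ => ?_
      by_cases h1 : p ∈ S <;> by_cases h2 : q ∈ S <;> simp [h1, h2]
    rw [this]
    have b : ∀ p ∈ T, ∑ q ∈ T, ((P.filter (fun S => p ∈ S ∧ q ∈ S)).card : ℝ) ≤
        C + T.card * (C * r^2) := by
      intro p hp
      calc _ ≤ ∑ q ∈ T, ((if p = q then C else 0) + C * r^2) := by
            refine Finset.sum_le_sum fun q _ => ?_
            split_ifs with h
            · have : ((P.filter (fun S => p ∈ S ∧ q ∈ S)).card : ℝ) ≤ P.card := by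
                exact_mod_cast Finset.card_filter_le _ _
              have : 0 ≤ C * r^2 := by positivity
              linarith
            · rw [zero_add]; exact pair_count ℓ p q h
        _ = _ := by
            rw [Finset.sum_add_distrib]; simp [hp]
    calc _ ≤ ∑ p ∈ T, (C + T.card * (C * r^2)) := Finset.sum_le_sum b
      _ = _ := by simp; ring
  have e : ∑ S ∈ P, (((S ∩ T).card : ℝ) / T.card - θ) ^ 2 =
      (∑ S ∈ P, ((S ∩ T).card : ℝ) ^ 2) / T.card ^ 2 - 2 * θ * (∑ S ∈ P, ((S ∩ T).card : ℝ)) / T.card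
        + θ ^ 2 * C := by
    rw [← hPC, Finset.sum_div, Finset.mul_sum, Finset.sum_div, ← Finset.sum_sub_distrib, mul_comm (θ^2), ← nsmul_eq_mul,
      ← Finset.sum_const, ← Finset.sum_add_distrib]
    refine Finset.sum_congr rfl fun S _ => ?_
    field_simp
    ring
  rw [e, m1]
  have : (∑ S ∈ P, ((S ∩ T).card : ℝ) ^ 2) / T.card ^ 2 ≤ (T.card * C + T.card * T.card * (C * r ^ 2)) / T.card ^ 2 := by
    gcongr
  refine (add_le_add_left (sub_le_sub_right this _) _).trans (le_of_eq ?_)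
  field_simp
  ring

def emb {V : Type*} {k : ℕ} (g : V → Option (Fin k)) : Conf (V × Fin k) :=
  fun p => decide (g p.1 = some p.2)

def isS {V : Type*} {k : ℕ} (g : V → Option (Fin k)) : Conf V := fun v => (g v).isSome

lemma kstar_emb {V : Type*} [Fintype V] [DecidableEq V] {k : ℕ} (g : V → Option (Fin k)) :
    kstar (emb g) = isS g := by
  funext v
  simp only [kstar, emb, isS, decide_eq_true_eq]
  cases h : g v <;> simp

def Valid {V : Type*} [Fintype V] [DecidableEq V] {k : ℕ} (τ : Conf (V × Fin k)) : Prop :=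
  ∀ v : V, (Finset.univ.filter (fun i : Fin k => τ (v, i) = true)).card ≤ 1

lemma valid_emb {V : Type*} [Fintype V] [DecidableEq V] {k : ℕ} (g : V → Option (Fin k)) :
    Valid (emb g) := by
  intro v
  rw [Finset.card_le_one]
  intro a ha b hb
  simp only [emb, mem_filter, mem_univ, true_and, decide_eq_true_eq] at ha hb
  rw [ha] at hb
  exact Option.some.inj hb

lemma emb_inj {V : Type*} {k : ℕ} : Function.Injective (emb (V := V) (k := k)) := by
  intro g h hgh
  funext v
  ext i
  have := congrFun hgh (v, i)
  simpa [emb] using this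

lemma emb_surj {V : Type*} [Fintype V] [DecidableEq V] {k : ℕ} (τ : Conf (V × Fin k))
    (h : Valid τ) : ∃ g, emb g = τ := by
  refine ⟨fun v => if h : ∃ i, τ (v, i) = true then some h.choose else none, ?_⟩
  funext ⟨v, i⟩
  simp only [emb]
  rw [Bool.eq_iff_iff, decide_eq_true_eq]
  split_ifs with hv
  · rw [Option.some_inj]
    constructor
    · intro e
      rw [← e]; exact hv.choose_spec
    · intro e
      exact Finset.card_le_one.mp (h v) _ (by simpa using hv.choose_spec) _ (by simpa using e)
  · simp only [false_iff]
    intro e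
    exact hv ⟨i, e⟩

lemma sum_valid {V : Type*} [Fintype V] [DecidableEq V] {k : ℕ} (F : Conf (V × Fin k) → ℝ)
    (hF : ∀ τ, ¬ Valid τ → F τ = 0) : ∑ τ, F τ = ∑ g : V → Option (Fin k), F (emb g) := by
  symm
  rw [← Finset.sum_image (f := F) (fun a _ b _ h => emb_inj h)]
  apply Finset.sum_subset (subset_univ _)
  intro τ _ h
  apply hF
  intro hv
  obtain ⟨g, rfl⟩ := emb_surj τ hv
  exact h (Finset.mem_image_of_mem _ (mem_univ _))

lemma sum_prod_opt {V : Type*} [Fintype V] [DecidableEq V] {k : ℕ} (F : V → Option (Fin k) → ℝ) :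
    ∑ g : V → Option (Fin k), ∏ v, F v (g v) = ∏ v, (F v none + ∑ i, F v (some i)) := by
  simp_rw [← Fintype.sum_option]
  rw [Finset.prod_univ_sum, Fintype.piFinset_univ]

/-- number of elements of the block in the row of `v` -/
def aCnt {V : Type*} [Fintype V] [DecidableEq V] {k : ℕ} (S : Finset (V × Fin k)) (v : V) : ℕ :=
  (univ.filter (fun i : Fin k => (v, i) ∈ S)).card

def Wt {V : Type*} [Fintype V] [DecidableEq V] (μ : Conf V → ℝ) (x : V → ℝ) (r σ : Conf V) : ℝ :=
  μ σ * ∏ v, (if r v then (if σ v then 1 else 0) else if σ v then x v else 1)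

def Phi {V : Type*} [Fintype V] [DecidableEq V] (μ f : Conf V → ℝ) (x : V → ℝ) : ℝ :=
  ∑ r : Conf V, (∏ v, if r v then 1 - x v else 1) * Gw (Wt μ x r) f

lemma pow_plus {V : Type*} [Fintype V] [DecidableEq V] (c : ℝ) (σ : Conf V) :
    c ^ plusCount σ = ∏ v, if σ v then c else 1 := by
  rw [plusCount, plusSet, Finset.prod_ite]
  simp

lemma prod_ind {V : Type*} [Fintype V] (P : V → Prop) [DecidablePred P] :
    (∏ v, if P v then (1:ℝ) else 0) = if ∀ v, P v then 1 else 0 := by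
  by_cases h : ∀ v, P v
  · simp [h]
  · rw [if_neg h]
    push Not at h
    obtain ⟨v, hv⟩ := h
    exact Finset.prod_eq_zero (mem_univ v) (by simp [hv])

lemma count1 {V : Type*} [Fintype V] [DecidableEq V] {k : ℕ} (S : Finset (V × Fin k))
    (h : V → Option (Fin k)) (hS : ∀ v i, (v, i) ∈ S → h v ≠ some i) (σ : Conf V) :
    (∑ g : V → Option (Fin k), if isS g = σ ∧ ∀ p ∈ univ \ S, emb g p = emb h p then (1:ℝ) else 0) =
    ∏ v, (if isS h v then (if σ v then 1 else 0) else if σ v then (aCnt S v : ℝ) else 1) := by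
  have e : ∀ g : V → Option (Fin k),
      (if isS g = σ ∧ ∀ p ∈ univ \ S, emb g p = emb h p then (1:ℝ) else 0) =
      ∏ v, (fun (v : V) (o : Option (Fin k)) => if o.isSome = σ v ∧
        ∀ i, (v, i) ∉ S → (o = some i ↔ h v = some i) then (1:ℝ) else 0) v (g v) := by
    intro g
    simp only
    rw [prod_ind]
    congr 1
    simp only [funext_iff, isS, emb, mem_sdiff, mem_univ, true_and, Prod.forall, forall_and,
      decide_eq_decide]
  refine (Finset.sum_congr rfl fun g _ => e g).trans ?_
  refine (sum_prod_opt (fun (v : V) (o : Option (Fin k)) => if o.isSome = σ v ∧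
        ∀ i, (v, i) ∉ S → (o = some i ↔ h v = some i) then (1:ℝ) else 0)).trans ?_
  refine Finset.prod_congr rfl fun v _ => ?_
  simp only [isS]
  obtain hv | ⟨j, hv⟩ : h v = none ∨ ∃ j, h v = some j := by
    cases h v <;> simp
  · cases hσ : σ v
    · simp [hv]
    · simp [hv, aCnt, Finset.sum_boole]
      congr 1
      ext i
      simp
      constructor
      · intro H
        by_contra hc
        exact H i hc rfl
      · rintro H j hj rfl
        exact hj H
  · have hj : (v, j) ∉ S := fun hc => hS v j hc hv
    have h1 : ¬ ∀ i, (v, i) ∉ S → j ≠ i := fun H => H j hj rfl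
    have h2 : ∀ x, (∀ i, (v, i) ∉ S → (x = i ↔ j = i)) ↔ x = j := by
      intro x
      constructor
      · intro H
        exact (H j hj).mpr rfl
      · rintro rfl
        simp
    cases hσ : σ v
    · simp [hv, hj]
    · simp [hv, h2]

lemma count2 {V : Type*} [Fintype V] [DecidableEq V] {k : ℕ} (S : Finset (V × Fin k))
    (r : Conf V) :
    (∑ h : V → Option (Fin k), if isS h = r ∧ ∀ p ∈ S, emb h p = false then (1:ℝ) else 0) =
    ∏ v, (if r v then ((k : ℝ) - aCnt S v) else 1) := by
  have e : ∀ g : V → Option (Fin k),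
      (if isS g = r ∧ ∀ p ∈ S, emb g p = false then (1:ℝ) else 0) =
      ∏ v, (fun (v : V) (o : Option (Fin k)) => if o.isSome = r v ∧
        ∀ i, (v, i) ∈ S → o ≠ some i then (1:ℝ) else 0) v (g v) := by
    intro g
    simp only
    rw [prod_ind]
    congr 1
    simp only [funext_iff, isS, emb, Prod.forall, forall_and,
      decide_eq_false_iff_not, ne_eq]
  refine (Finset.sum_congr rfl fun g _ => e g).trans ?_
  refine (sum_prod_opt (fun (v : V) (o : Option (Fin k)) => if o.isSome = r v ∧
        ∀ i, (v, i) ∈ S → o ≠ some i then (1:ℝ) else 0)).trans ?_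
  refine Finset.prod_congr rfl fun v _ => ?_
  cases hr : r v
  · simp
  · have h2 : ∀ x, (∀ i, (v, i) ∈ S → ¬ x = i) ↔ (v, x) ∉ S := by
      intro x
      constructor
      · intro H hc
        exact H x hc rfl
      · rintro H i hi rfl
        exact H hi
    have h3 := Finset.card_filter_add_card_filter_not (s := (univ : Finset (Fin k))) (fun i => (v, i) ∈ S)
    simp only [card_univ, Fintype.card_fin] at h3
    have h4 : (k:ℝ) = aCnt S v + (univ.filter (fun i : Fin k => (v, i) ∉ S)).card := by
      unfold aCnt; exact_mod_cast h3.symm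
    have h5 : (∑ x : Fin k, if (v, x) ∈ S then (0:ℝ) else 1) =
        (univ.filter (fun i : Fin k => (v, i) ∉ S)).card := by
      rw [← Finset.sum_boole]
      refine Finset.sum_congr rfl fun x _ => ?_
      by_cases hx : (v, x) ∈ S <;> simp [hx]
    simp [h2]
    linarith

lemma weight_push {V : Type*} [Fintype V] [DecidableEq V] {k : ℕ} (hk : 0 < k) (μ : Conf V → ℝ)
    (S : Finset (V × Fin k))
    (h : V → Option (Fin k)) (hS : ∀ v i, (v, i) ∈ S → h v ≠ some i) (f : Conf V → ℝ) :
    Gw (fun τ => if ∀ p ∈ univ \ S, τ p = emb h p then ktrans μ k τ else 0) (fun σ => f (kstar σ)) =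
    ((k:ℝ)⁻¹) ^ plusCount (isS h) * Gw (Wt μ (fun v => (aCnt S v : ℝ) / k) (isS h)) f := by
  have hk' : (k:ℝ) ≠ 0 := by positivity
  rw [← Gw_smul _ (by positivity)]
  apply Gw_push kstar
  intro g
  rw [sum_valid]
  · have e1 : ∀ σ : Conf V, (k:ℝ)⁻¹ ^ plusCount (isS h) * Wt μ (fun v => (aCnt S v : ℝ) / k) (isS h) σ * g σ
        = ∑ q : V → Option (Fin k), (if isS q = σ ∧ ∀ p ∈ univ \ S, emb q p = emb h p then (1:ℝ) else 0)
          * (μ σ * (k:ℝ)⁻¹ ^ plusCount σ * g σ) := by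
      intro σ
      rw [← Finset.sum_mul, count1 S h hS, Wt, pow_plus, pow_plus]
      have : (∏ v, if isS h v = true then (k:ℝ)⁻¹ else 1) *
          ∏ v, (if isS h v = true then (if σ v = true then (1:ℝ) else 0) else if σ v = true then (aCnt S v : ℝ) / k else 1)
          = (∏ v, (if isS h v = true then (if σ v = true then (1:ℝ) else 0) else if σ v = true then (aCnt S v : ℝ) else 1)) *
          ∏ v, if σ v = true then (k:ℝ)⁻¹ else 1 := by
        rw [← Finset.prod_mul_distrib, ← Finset.prod_mul_distrib]
        refine Finset.prod_congr rfl fun v _ => ?_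
        split_ifs <;> simp [div_eq_mul_inv]
      linear_combination (μ σ * g σ) * this
    simp_rw [e1]
    rw [Finset.sum_comm]
    refine Finset.sum_congr rfl fun q _ => ?_
    rw [Finset.sum_eq_single (isS q)]
    · have hq := valid_emb q
      unfold Valid at hq
      rw [kstar_emb, ktrans, if_pos hq, kstar_emb]
      simp only [true_and]
      split_ifs <;> simp
    · intro b _ hb
      rw [if_neg (fun hc => hb hc.1.symm), zero_mul]
    · simp
  · intro τ hτ
    have : ktrans μ k τ = 0 := by
      unfold Valid at hτ
      rw [ktrans, if_neg hτ]
    simp [this]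

lemma ktrans_nonneg {V : Type*} [Fintype V] [DecidableEq V] (μ : Conf V → ℝ) (hμ : ∀ σ, 0 ≤ μ σ)
    (k : ℕ) (τ : Conf (V × Fin k)) : 0 ≤ ktrans μ k τ := by
  unfold ktrans
  split_ifs
  · exact mul_nonneg (hμ _) (by positivity)
  · exact le_rfl

lemma avgEnt_eq {V : Type*} [Fintype V] [DecidableEq V] {k : ℕ} (hk : 0 < k) (μ : Conf V → ℝ)
    (hμ : ∀ σ, 0 ≤ μ σ) (S : Finset (V × Fin k)) (f : Conf V → ℝ) :
    avgEnt (ktrans μ k) S (fun σ => f (kstar σ)) = Phi μ f (fun v => (aCnt S v : ℝ) / k) := by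
  have hk' : (k:ℝ) ≠ 0 := by positivity
  unfold avgEnt
  simp_rw [margin_ent _ (ktrans_nonneg μ hμ k)]
  rw [sum_valid]
  · have e1 : ∀ h : V → Option (Fin k), (if ∀ v ∈ S, emb h v = false then
        Gw (fun τ => if ∀ p ∈ univ \ S, τ p = emb h p then ktrans μ k τ else 0) (fun σ => f (kstar σ)) else 0)
        = ∑ r : Conf V, (if isS h = r ∧ ∀ p ∈ S, emb h p = false then (1:ℝ) else 0) *
          ((k:ℝ)⁻¹ ^ plusCount r * Gw (Wt μ (fun v => (aCnt S v : ℝ) / k) r) f) := by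
      intro h
      rw [Finset.sum_eq_single (isS h)]
      · by_cases hS : ∀ v ∈ S, emb h v = false
        · rw [if_pos hS, if_pos ⟨rfl, hS⟩, one_mul, weight_push hk]
          intro v i hvi
          simpa [emb] using hS (v, i) hvi
        · rw [if_neg hS, if_neg (fun hc => hS hc.2), zero_mul]
      · intro b _ hb
        rw [if_neg (fun hc => hb hc.1.symm), zero_mul]
      · simp
    simp_rw [e1]
    rw [Finset.sum_comm]
    unfold Phi
    refine Finset.sum_congr rfl fun r _ => ?_
    rw [← Finset.sum_mul, count2, pow_plus, ← mul_assoc, ← Finset.prod_mul_distrib]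
    congr 1
    refine Finset.prod_congr rfl fun v _ => ?_
    split_ifs
    · field_simp
    · simp
  · intro χ hχ
    split_ifs with hS
    · apply Gw_zero
      intro τ
      split_ifs with hτ
      · unfold ktrans
        rw [if_neg]
        intro hv
        apply hχ
        intro v
        refine le_trans (Finset.card_le_card ?_) (hv v)
        intro i hi
        simp only [mem_filter, mem_univ, true_and] at hi ⊢
        have hn : (v, i) ∉ S := by
          intro hc
          rw [hS _ hc] at hi
          exact absurd hi (by simp)
        rw [hτ (v, i) (by simp [hn]), hi]
      · rfl
    · rfl

lemma Wt_cont {V : Type*} [Fintype V] [DecidableEq V] (μ : Conf V → ℝ) (r σ : Conf V) :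
    Continuous (fun x : V → ℝ => Wt μ x r σ) := by
  unfold Wt
  refine continuous_const.mul (continuous_finset_prod _ fun v _ => ?_)
  split_ifs <;> fun_prop

lemma Wt_nonneg {V : Type*} [Fintype V] [DecidableEq V] (μ : Conf V → ℝ) (hμ : ∀ σ, 0 ≤ μ σ)
    (x : V → ℝ) (hx : ∀ v, 0 ≤ x v) (r σ : Conf V) : 0 ≤ Wt μ x r σ := by
  unfold Wt
  refine mul_nonneg (hμ _) (Finset.prod_nonneg fun v _ => ?_)
  have := hx v
  split_ifs <;> first | positivity | exact this

lemma Wt_le {V : Type*} [Fintype V] [DecidableEq V] (μ : Conf V → ℝ) (hμ : ∀ σ, 0 ≤ μ σ)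
    (x : V → ℝ) (hx : ∀ v, 0 ≤ x v) (hx1 : ∀ v, x v ≤ 1) (r σ : Conf V) : Wt μ x r σ ≤ μ σ := by
  unfold Wt
  refine mul_le_of_le_one_right (hμ _) (Finset.prod_le_one (fun v _ => ?_) (fun v _ => ?_))
  · have := hx v
    split_ifs <;> first | positivity | exact this
  · have := hx1 v
    split_ifs <;> first | exact this | norm_num

lemma Gw_cont {V : Type*} [Fintype V] [DecidableEq V] (μ f : Conf V → ℝ) (hμ : ∀ σ, 0 ≤ μ σ)
    (θ : ℝ) (hθ : 0 < θ) (r : Conf V) :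
    ContinuousAt (fun x : V → ℝ => Gw (Wt μ x r) f) (fun _ => θ) := by
  by_cases h : ∑ σ, Wt μ (fun _ => θ) r σ = 0
  · have hz : ∀ x : V → ℝ, Gw (Wt μ x r) f = 0 := by
      intro x
      apply Gw_zero
      intro σ
      rw [Finset.sum_eq_zero_iff_of_nonneg
        (fun σ _ => Wt_nonneg μ hμ _ (fun _ => hθ.le) r σ)] at h
      have h1 := h σ (mem_univ _)
      unfold Wt at h1 ⊢
      rcases mul_eq_zero.mp h1 with h2 | h2
      · rw [h2, zero_mul]
      · obtain ⟨v, -, hv⟩ := Finset.prod_eq_zero_iff.mp h2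
        rw [Finset.prod_eq_zero (mem_univ v), mul_zero]
        split_ifs at hv ⊢
        · exact absurd hv (by norm_num)
        · rfl
        · exact absurd hv hθ.ne'
        · exact absurd hv (by norm_num)
    simp only [hz]
    exact continuousAt_const
  · unfold Gw
    have hc : ∀ g : Conf V → ℝ, Continuous fun x : V → ℝ => ∑ σ, Wt μ x r σ * g σ := fun g =>
      continuous_finset_sum _ fun σ _ => (Wt_cont μ r σ).mul continuous_const
    have hs : Continuous fun x : V → ℝ => ∑ σ, Wt μ x r σ :=
      continuous_finset_sum _ fun σ _ => Wt_cont μ r σ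
    have hd : ContinuousAt (fun x : V → ℝ => (∑ σ, Wt μ x r σ * f σ) / ∑ σ, Wt μ x r σ) (fun _ => θ) :=
      (hc f).continuousAt.div hs.continuousAt h
    refine ((hc _).continuousAt).sub (hs.continuousAt.mul ?_)
    exact ContinuousAt.comp (g := fun t : ℝ => t * Real.log t) Real.continuous_mul_log.continuousAt hd

lemma Phi_cont {V : Type*} [Fintype V] [DecidableEq V] (μ f : Conf V → ℝ) (hμ : ∀ σ, 0 ≤ μ σ)
    (θ : ℝ) (hθ : 0 < θ) : ContinuousAt (Phi μ f) (fun _ => θ) := by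
  unfold Phi
  refine tendsto_finset_sum _ fun r _ => ?_
  refine ContinuousAt.mul (f := fun x : V → ℝ => ∏ v, if r v then 1 - x v else 1) ?_
    (Gw_cont μ f hμ θ hθ r)
  refine Continuous.continuousAt (continuous_finset_prod _ fun v _ => ?_)
  split_ifs <;> fun_prop

lemma Gw_bound {A : Type*} [Fintype A] (f : A → ℝ) (hf : ∀ a, 0 ≤ f a) :
    ∃ C : ℝ, 0 ≤ C ∧ ∀ w : A → ℝ, (∀ a, 0 ≤ w a) → |Gw w f| ≤ 2 * C * ∑ a, w a := by
  obtain ⟨C, hC⟩ := (isCompact_Icc (a := (0:ℝ)) (b := ∑ a, f a)).exists_bound_of_continuousOn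
    (f := fun t : ℝ => t * Real.log t) Real.continuous_mul_log.continuousOn
  have hfM : ∀ a, f a ≤ ∑ a, f a := fun a =>
    Finset.single_le_sum (f := f) (fun i _ => hf i) (mem_univ a)
  have hM : 0 ≤ ∑ a, f a := Finset.sum_nonneg fun i _ => hf i
  simp only [Real.norm_eq_abs] at hC
  refine ⟨C, (abs_nonneg _).trans (hC 0 ⟨le_rfl, hM⟩), fun w hw => ?_⟩
  unfold Gw
  have hm : 0 ≤ ∑ a, w a := Finset.sum_nonneg fun i _ => hw i
  have h1 : |∑ a, w a * (f a * Real.log (f a))| ≤ C * ∑ a, w a := by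
    refine (Finset.abs_sum_le_sum_abs _ _).trans ?_
    rw [Finset.mul_sum]
    refine Finset.sum_le_sum fun a _ => ?_
    rw [abs_mul, abs_of_nonneg (hw a), mul_comm C]
    exact mul_le_mul_of_nonneg_left (hC _ ⟨hf a, hfM a⟩) (hw a)
  have h2 := hC ((∑ a, w a * f a) / ∑ a, w a) ⟨div_nonneg
    (Finset.sum_nonneg fun i _ => mul_nonneg (hw i) (hf i)) hm, by
      apply div_le_of_le_mul₀ hm hM
      rw [Finset.mul_sum]
      refine Finset.sum_le_sum fun a _ => ?_
      rw [mul_comm]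
      exact mul_le_mul_of_nonneg_right (hfM a) (hw a)⟩
  have h3 : |(∑ a, w a) * (((∑ a, w a * f a) / ∑ a, w a) * Real.log ((∑ a, w a * f a) / ∑ a, w a))|
      ≤ C * ∑ a, w a := by
    rw [abs_mul, abs_of_nonneg hm, mul_comm C]
    exact mul_le_mul_of_nonneg_left h2 hm
  refine (abs_sub _ _).trans ?_
  linarith

lemma Phi_bound {V : Type*} [Fintype V] [DecidableEq V] (μ f : Conf V → ℝ) (hμ : IsDist μ)
    (hf : ∀ σ, 0 ≤ f σ) : ∃ B : ℝ, 0 ≤ B ∧ ∀ x : V → ℝ, (∀ v, 0 ≤ x v) → (∀ v, x v ≤ 1) →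
      |Phi μ f x| ≤ B := by
  obtain ⟨C, hC0, hC⟩ := Gw_bound f hf
  refine ⟨∑ r : Conf V, 2 * C, by positivity, fun x hx hx1 => ?_⟩
  unfold Phi
  refine (Finset.abs_sum_le_sum_abs _ _).trans (Finset.sum_le_sum fun r _ => ?_)
  have h1 : ∀ v ∈ (univ : Finset V), 0 ≤ (if r v = true then 1 - x v else 1) := by
    intro v _
    have := hx1 v
    split_ifs <;> linarith
  have h2 : ∀ v ∈ (univ : Finset V), (if r v = true then 1 - x v else 1) ≤ 1 := by
    intro v _
    have := hx v
    split_ifs <;> linarith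
  have h3 := Finset.prod_le_one h1 h2
  have h4 := Finset.prod_nonneg h1
  have h5 := hC (Wt μ x r) (Wt_nonneg μ hμ.1 x hx r)
  have h6 : ∑ σ, Wt μ x r σ ≤ 1 := by
    rw [← hμ.2]
    exact Finset.sum_le_sum fun σ _ => Wt_le μ hμ.1 x hx hx1 r σ
  rw [abs_mul, abs_of_nonneg h4]
  calc _ ≤ |Gw (Wt μ x r) f| := mul_le_of_le_one_left (abs_nonneg _) h3
    _ ≤ _ := h5
    _ ≤ 2 * C * 1 := by gcongr
    _ = _ := mul_one _

lemma Phi_quad {V : Type*} [Fintype V] [DecidableEq V] (μ f : Conf V → ℝ) (hμ : IsDist μ)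
    (hf : ∀ σ, 0 ≤ f σ) (θ : ℝ) (hθ : 0 < θ) (hθ1 : θ < 1) (ε : ℝ) (hε : 0 < ε) :
    ∃ D : ℝ, 0 ≤ D ∧ ∀ x : V → ℝ, (∀ v, 0 ≤ x v) → (∀ v, x v ≤ 1) →
      |Phi μ f x - Phi μ f (fun _ => θ)| ≤ ε + D * ∑ v, (x v - θ) ^ 2 := by
  obtain ⟨B, hB0, hB⟩ := Phi_bound μ f hμ hf
  obtain ⟨δ, hδ, hd⟩ := Metric.continuousAt_iff.mp (Phi_cont μ f hμ.1 θ hθ) ε hε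
  refine ⟨2 * B / δ ^ 2, by positivity, fun x hx hx1 => ?_⟩
  have hs : 0 ≤ ∑ v, (x v - θ) ^ 2 := Finset.sum_nonneg fun _ _ => sq_nonneg _
  by_cases h : ∀ v, |x v - θ| < δ
  · have h1 : dist x (fun _ => θ) < δ := by
      rw [dist_pi_lt_iff hδ]
      exact h
    have h2 := hd h1
    rw [Real.dist_eq] at h2
    have : 0 ≤ 2 * B / δ ^ 2 * ∑ v, (x v - θ) ^ 2 := by positivity
    linarith
  · push Not at h
    obtain ⟨v, hv⟩ := h
    have h1 : δ ^ 2 ≤ ∑ v, (x v - θ) ^ 2 := by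
      calc δ ^ 2 ≤ |x v - θ| ^ 2 := by gcongr
        _ = (x v - θ) ^ 2 := sq_abs _
        _ ≤ _ := Finset.single_le_sum (f := fun v => (x v - θ) ^ 2) (fun _ _ => sq_nonneg _) (mem_univ v)
    have h2 : 2 * B ≤ 2 * B / δ ^ 2 * ∑ v, (x v - θ) ^ 2 := by
      rw [div_mul_eq_mul_div, le_div_iff₀ (by positivity)]
      gcongr
    have h3 := hB x hx hx1
    have h4 := hB (fun _ => θ) (fun _ => hθ.le) (fun _ => hθ1.le)
    have h5 := abs_sub (Phi μ f x) (Phi μ f (fun _ => θ))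
    linarith

lemma Phi_theta {V : Type*} [Fintype V] [DecidableEq V] (μ f : Conf V → ℝ) (hμ : IsDist μ)
    (θ : ℝ) (hθ : 0 < θ) :
    Phi μ f (fun _ => θ) = (Zmag μ θ / θ ^ (Fintype.card V)) *
        ∑ R : Finset V, binWeight θ R * mbfTerm μ θ f R := by
  have hZ : 0 < Zmag μ θ := by
    unfold Zmag
    have hn : ∀ σ ∈ (univ : Finset (Conf V)), 0 ≤ μ σ * θ ^ plusCount σ := fun σ _ =>
      mul_nonneg (hμ.1 σ) (by positivity)
    refine lt_of_le_of_ne (Finset.sum_nonneg hn) (fun hc => ?_)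
    have h0 := (Finset.sum_eq_zero_iff_of_nonneg hn).mp hc.symm
    have : ∑ σ, μ σ = 0 := Finset.sum_eq_zero fun σ hσ => by
      rcases mul_eq_zero.mp (h0 σ hσ) with h | h
      · exact h
      · exact absurd h (by positivity)
    rw [hμ.2] at this
    exact one_ne_zero this
  have hmag : ∀ σ, magnetizeC μ θ σ = μ σ * θ ^ plusCount σ / Zmag μ θ := by
    intro σ
    simp only [magnetizeC, magnetize, Zmag, pow_plus]
  have hpi : ∀ σ, 0 ≤ magnetizeC μ θ σ := by
    intro σ
    rw [hmag]
    exact div_nonneg (mul_nonneg (hμ.1 σ) (by positivity)) hZ.le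
  rw [Finset.mul_sum]
  unfold Phi
  refine Finset.sum_bij' (fun r _ => plusSet r) (fun R _ => fun v => decide (v ∈ R)) (by simp) (by simp)
    (by intro r _; funext v; simp [plusSet]) (by intro R _; ext v; simp [plusSet]) ?_
  intro r _
  rw [mbfTerm, margin_ent _ hpi, binWeight]
  have hle : (plusSet r).card ≤ Fintype.card V := Finset.card_le_univ _
  have hW : Wt μ (fun _ => θ) r = fun σ => (Zmag μ θ / θ ^ (plusSet r).card) *
      (if ∀ v ∈ plusSet r, σ v = true then magnetizeC μ θ σ else 0) := by
    funext σ
    have e1 : (if ∀ v ∈ plusSet r, σ v = true then (1:ℝ) else 0) =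
        ∏ v, if r v = true → σ v = true then (1:ℝ) else 0 := by
      rw [prod_ind]
      simp [plusSet]
    have e2 : (if ∀ v ∈ plusSet r, σ v = true then magnetizeC μ θ σ else 0) =
        (if ∀ v ∈ plusSet r, σ v = true then (1:ℝ) else 0) * magnetizeC μ θ σ := by
      split_ifs <;> simp
    have e3 : θ ^ (plusSet r).card * ∏ v, (if r v = true then (if σ v = true then (1:ℝ) else 0) else if σ v = true then θ else 1)
        = (∏ v, if r v = true → σ v = true then (1:ℝ) else 0) * θ ^ plusCount σ := by
      have := pow_plus θ r
      rw [plusCount] at this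
      rw [this, pow_plus, ← Finset.prod_mul_distrib, ← Finset.prod_mul_distrib]
      refine Finset.prod_congr rfl fun v _ => ?_
      cases r v <;> cases σ v <;> simp
    rw [e2, hmag, e1, Wt]
    field_simp
    linear_combination μ σ * e3
  rw [hW, Gw_smul _ (by positivity)]
  have e4 : (∏ v, if r v = true then 1 - θ else 1) = (1 - θ) ^ (plusSet r).card := by
    rw [← pow_plus, plusCount]
  have e5 : θ ^ Fintype.card V = θ ^ (plusSet r).card * θ ^ (Fintype.card V - (plusSet r).card) := by
    rw [← pow_add]; congr 1; omega
  rw [e4, e5]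
  field_simp

lemma aCnt_eq {V : Type*} [Fintype V] [DecidableEq V] {k : ℕ} (S : Finset (V × Fin k)) (v : V) :
    aCnt S v = (S ∩ univ.image (fun i : Fin k => (v, i))).card := by
  unfold aCnt
  rw [← Finset.card_image_of_injective (f := fun i : Fin k => (v, i)) _ (fun a b h => by simpa using h)]
  congr 1
  ext ⟨u, i⟩
  simp only [mem_image, mem_filter, mem_univ, true_and, mem_inter, Prod.mk.injEq]
  constructor
  · rintro ⟨j, hj, rfl, rfl⟩
    exact ⟨hj, j, rfl, rfl⟩
  · rintro ⟨h, j, rfl, rfl⟩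
    exact ⟨j, h, rfl, rfl⟩

lemma aCnt_moment {V : Type*} [Fintype V] [DecidableEq V] {k : ℕ} (hk : 0 < k) (θ : ℝ) (hθ : 0 < θ)
    (v : V) :
    ∑ S ∈ powersetCard ⌈θ * (Fintype.card V : ℝ) * (k : ℝ)⌉₊ (univ : Finset (V × Fin k)),
      ((aCnt S v : ℝ) / k - θ) ^ 2 ≤
    (Nat.choose (Fintype.card V * k) (⌈θ * (Fintype.card V : ℝ) * (k : ℝ)⌉₊) : ℝ) * (2 / k) := by
  set ℓ := ⌈θ * (Fintype.card V : ℝ) * (k : ℝ)⌉₊ with hℓ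
  have hT : (univ.image (fun i : Fin k => (v, i))).card = k := by
    rw [Finset.card_image_of_injective _ (fun a b h => by simpa using h)]
    simp
  have hm := second_moment ℓ (univ.image (fun i : Fin k => (v, i))) (by rw [hT]; exact hk) θ
  simp only [← aCnt_eq, hT, Fintype.card_prod, Fintype.card_fin] at hm
  refine hm.trans (mul_le_mul_of_nonneg_left ?_ (Nat.cast_nonneg _))
  have hn : (1:ℝ) ≤ Fintype.card V := by exact_mod_cast Fintype.card_pos_iff.mpr ⟨v⟩
  have hk1 : (1:ℝ) ≤ k := by exact_mod_cast hk
  have a1 : θ * (Fintype.card V : ℝ) * (k : ℝ) ≤ ℓ := Nat.le_ceil _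
  have a2 : (ℓ:ℝ) < θ * (Fintype.card V : ℝ) * (k : ℝ) + 1 := Nat.ceil_lt_add_one (by positivity)
  push_cast
  have b1 : 0 ≤ (ℓ:ℝ) / (Fintype.card V * k) - θ := by
    rw [sub_nonneg, le_div_iff₀ (by positivity)]; linarith
  have b2 : (ℓ:ℝ) / (Fintype.card V * k) - θ ≤ 1 / k := by
    rw [sub_le_iff_le_add, div_le_iff₀ (by positivity)]
    have : (1 / (k:ℝ) + θ) * (Fintype.card V * k) = Fintype.card V + θ * Fintype.card V * k := by
      field_simp
    rw [this]; linarith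
  have b3 : 1 / (k:ℝ) ≤ 1 := by rw [div_le_one (by positivity)]; exact hk1
  have b4 : ((ℓ:ℝ) / (Fintype.card V * k) - θ)^2 ≤ 1 / k := by nlinarith
  calc _ ≤ 1 / (k:ℝ) + 1 / k := by linarith
    _ = 2 / k := by ring

/-- Limit of the uniform-block entropy averages:
`lim_{k→∞} H_f(⌈θnk⌉,k) = (Z_π/θ^n) E_{R∼Bin(V,1−θ)}[π_R(𝟙_R) Ent_{π^{𝟙_R}}[f]]`. -/
theorem ubf_average_limit {V : Type*} [Fintype V] [DecidableEq V]
    (μ : Conf V → ℝ) (hμ : IsDist μ) (θ : ℝ) (hθ : 0 < θ) (hθ1 : θ < 1)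
    (f : Conf V → ℝ) (hf : ∀ σ, 0 ≤ f σ) :
    Filter.Tendsto
      (fun k : ℕ =>
        (Nat.choose (Fintype.card V * k) (⌈θ * (Fintype.card V : ℝ) * (k : ℝ)⌉₊) : ℝ)⁻¹ *
          ∑ S ∈ Finset.powersetCard (⌈θ * (Fintype.card V : ℝ) * (k : ℝ)⌉₊)
              (Finset.univ : Finset (V × Fin k)),
            avgEnt (ktrans μ k) S (fun σ => f (kstar σ)))
      Filter.atTop
      (nhds ((Zmag μ θ / θ ^ (Fintype.card V)) *
        ∑ R : Finset V, binWeight θ R * mbfTerm μ θ f R)) := by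
  rw [← Phi_theta μ f hμ θ hθ, Metric.tendsto_atTop]
  intro ε hε
  obtain ⟨D, hD, hq⟩ := Phi_quad μ f hμ hf θ hθ hθ1 (ε / 2) (by positivity)
  obtain ⟨K, hK⟩ := exists_nat_gt (D * Fintype.card V * 2 / (ε / 2))
  refine ⟨K + 1, fun k hk => ?_⟩
  have hk0 : 0 < k := by omega
  have hkR : (0:ℝ) < k := by exact_mod_cast hk0
  have hKk : (K:ℝ) ≤ k := by exact_mod_cast (by omega : K ≤ k)
  have hmom := fun v : V => aCnt_moment hk0 θ hθ v
  set ℓ := ⌈θ * (Fintype.card V : ℝ) * (k : ℝ)⌉₊ with hℓ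
  set P := powersetCard ℓ (univ : Finset (V × Fin k)) with hP
  have hPC : (P.card : ℝ) = (Nat.choose (Fintype.card V * k) ℓ : ℝ) := by
    rw [hP, Finset.card_powersetCard, Finset.card_univ, Fintype.card_prod, Fintype.card_fin]
  have hle : ℓ ≤ Fintype.card V * k := by
    rw [hℓ, Nat.ceil_le]
    push_cast
    rw [mul_assoc]
    exact mul_le_of_le_one_left (by positivity) hθ1.le
  have hC : (0:ℝ) < (Nat.choose (Fintype.card V * k) ℓ : ℝ) := by
    exact_mod_cast Nat.choose_pos hle
  rw [← hPC] at hmom hC ⊢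
  rw [Finset.sum_congr rfl (fun S _ => avgEnt_eq hk0 μ hμ.1 S f), Real.dist_eq]
  have e1 : (P.card : ℝ)⁻¹ * ∑ S ∈ P, Phi μ f (fun v => (aCnt S v : ℝ) / k) - Phi μ f (fun _ => θ) =
      (P.card : ℝ)⁻¹ * ∑ S ∈ P, (Phi μ f (fun v => (aCnt S v : ℝ) / k) - Phi μ f (fun _ => θ)) := by
    rw [Finset.sum_sub_distrib, Finset.sum_const, nsmul_eq_mul]
    field_simp
  have ha : ∀ S : Finset (V × Fin k), ∀ v, (aCnt S v : ℝ) ≤ k := by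
    intro S v
    have : aCnt S v ≤ k := (Finset.card_filter_le _ _).trans (by simp)
    exact_mod_cast this
  have e2 : |∑ S ∈ P, (Phi μ f (fun v => (aCnt S v : ℝ) / k) - Phi μ f (fun _ => θ))| ≤
      P.card * (ε / 2 + D * (Fintype.card V * (2 / k))) := by
    calc _ ≤ ∑ S ∈ P, |Phi μ f (fun v => (aCnt S v : ℝ) / k) - Phi μ f (fun _ => θ)| :=
          Finset.abs_sum_le_sum_abs _ _
      _ ≤ ∑ S ∈ P, (ε / 2 + D * ∑ v, ((aCnt S v : ℝ) / k - θ) ^ 2) :=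
          Finset.sum_le_sum fun S _ => hq _ (fun v => by positivity)
            (fun v => (div_le_one hkR).mpr (ha S v))
      _ = P.card * (ε / 2) + D * ∑ v, ∑ S ∈ P, ((aCnt S v : ℝ) / k - θ) ^ 2 := by
          rw [Finset.sum_add_distrib, ← Finset.mul_sum, Finset.sum_comm, Finset.sum_const,
            nsmul_eq_mul]
      _ ≤ P.card * (ε / 2) + D * ∑ v : V, (P.card * (2 / (k:ℝ))) := by
          gcongr with v _
          exact hmom v
      _ = _ := by
          rw [Finset.sum_const, nsmul_eq_mul, Finset.card_univ]; ring
  rw [e1, abs_mul, abs_of_pos (inv_pos.mpr hC)]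
  have e3 : D * (Fintype.card V * (2 / (k:ℝ))) < ε / 2 := by
    have : D * Fintype.card V * 2 / (ε / 2) < k := hK.trans_le hKk
    rw [div_lt_iff₀ (by positivity)] at this
    have e : D * (Fintype.card V * (2 / (k:ℝ))) = D * Fintype.card V * 2 / k := by ring
    rw [e, div_lt_iff₀ hkR]
    linarith
  calc _ ≤ (P.card : ℝ)⁻¹ * (P.card * (ε / 2 + D * (Fintype.card V * (2 / k)))) := by gcongr
    _ = ε / 2 + D * (Fintype.card V * (2 / k)) := by field_simp
    _ < ε := by linarith
end
end

section
/- Let μ be a distribution over {-1,+1}^V, k ≥ 1 an integer, μ_k = Trans(μ, k) over {-1,+1}^{V_k} with V_k = V×[k]. Fix S ⊆ V_k, σ ∈ Ω(μ_k) and let ρ = σ restricted to V_k∖S. Let F(ρ) = {v ∈ V : there exists i ∈ [k] with (v,i) ∈ V_k∖S and σ_{(v,i)} = +1}, and define fields φ_ρ on V∖F(ρ) by φ_ρ(v) = |S ∩ ({v}×[k])| / k. Then for every f: {-1,+1}^V → ℝ_{≥0}: Ent_{μ_k^ρ}[f^k] = Ent_{μ^{(φ_ρ), 𝟙_{F(ρ)}}}[f].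 -/
open Classical Finset

noncomputable section

open PaperIsing

theorem kt_local_true {k : ℕ} (P : Fin k → Prop) (s : Fin k → Bool)
    (hs : (Finset.univ.filter (fun i : Fin k => s i = true)).card ≤ 1) :
    (Finset.univ.filter (fun t : Fin k → Bool => (∀ i, ¬ P i → t i = s i) ∧
      (Finset.univ.filter (fun i : Fin k => t i = true)).card ≤ 1 ∧ ∃ i, t i = true)).card
    = if ∃ i, ¬ P i ∧ s i = true then 1 else (Finset.univ.filter P).card := by
  simp only [Finset.card_le_one, Finset.mem_filter, Finset.mem_univ, true_and] at hs ⊢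
  split_ifs with h
  · obtain ⟨i0, hP, hi⟩ := h
    rw [Finset.card_eq_one]
    refine ⟨fun i => decide (i = i0), ?_⟩
    ext t
    simp only [Finset.mem_filter, Finset.mem_univ, true_and, Finset.mem_singleton]
    constructor
    · rintro ⟨h1, h2, h3⟩
      funext j
      have h4 : t i0 = true := by rw [h1 _ hP, hi]
      by_cases hj : j = i0
      · subst hj; simp [h4]
      · have : t j ≠ true := fun h => hj (h2 _ h _ h4)
        simp [hj, this]
    · rintro rfl
      refine ⟨?_, by simp, ⟨i0, by simp⟩⟩
      intro i hi'
      by_cases hj : i = i0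
      · subst hj; simp [hi]
      · have : s i ≠ true := fun h => hj (hs _ h _ hi)
        simp [hj, this]
  · push Not at h
    symm
    apply Finset.card_bij (fun a _ => fun i => decide (i = a))
    · intro a ha
      simp only [Finset.mem_filter, Finset.mem_univ, true_and] at ha ⊢
      refine ⟨?_, by simp, ⟨a, by simp⟩⟩
      intro i hi
      have h1 : i ≠ a := fun h => hi (h ▸ ha)
      have h2 := h i hi
      simp [h1]
      simpa using h2
    · intro a _ b _ hab
      have := congrFun hab a
      simpa using this
    · intro t ht
      simp only [Finset.mem_filter, Finset.mem_univ, true_and] at ht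
      obtain ⟨h1, h2, a, h3⟩ := ht
      refine ⟨a, ?_, ?_⟩
      · simp only [Finset.mem_filter, Finset.mem_univ, true_and]
        by_contra hP
        exact h a hP (by rw [← h1 a hP, h3])
      · funext j
        by_cases hj : j = a
        · subst hj; simp [h3]
        · have : t j ≠ true := fun h => hj (h2 _ h _ h3)
          simp [hj, this]

theorem kt_local_false {k : ℕ} (P : Fin k → Prop) (s : Fin k → Bool) :
    (Finset.univ.filter (fun t : Fin k → Bool => (∀ i, ¬ P i → t i = s i) ∧
      (Finset.univ.filter (fun i : Fin k => t i = true)).card ≤ 1 ∧ ¬ ∃ i, t i = true)).card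
    = if ∃ i, ¬ P i ∧ s i = true then 0 else 1 := by
  simp only [Finset.card_le_one, Finset.mem_filter, Finset.mem_univ, true_and]
  split_ifs with h
  · obtain ⟨i0, hP, hi⟩ := h
    rw [Finset.card_eq_zero, Finset.filter_eq_empty_iff]
    rintro t - ⟨h1, h2, h3⟩
    exact h3 ⟨i0, by rw [h1 _ hP, hi]⟩
  · push Not at h
    rw [Finset.card_eq_one]
    refine ⟨fun _ => false, ?_⟩
    ext t
    simp only [Finset.mem_filter, Finset.mem_univ, true_and, Finset.mem_singleton]
    constructor
    · rintro ⟨h1, h2, h3⟩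
      funext j
      push Not at h3
      simpa using h3 j
    · rintro rfl
      refine ⟨?_, by simp, by simp⟩
      intro i hi
      have := h i hi
      simp at this
      simp [this]

/-- local weight -/
def ktw {k : ℕ} (P : Fin k → Prop) (s : Fin k → Bool) (b : Bool) (t : Fin k → Bool) : ℝ :=
  if (∀ i, ¬ P i → t i = s i) ∧
      (Finset.univ.filter (fun i : Fin k => t i = true)).card ≤ 1 ∧
      (b = true ↔ ∃ i, t i = true) then (if b = true then (k : ℝ)⁻¹ else 1) else 0

theorem ktw_sum {k : ℕ} (P : Fin k → Prop) (s : Fin k → Bool)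
    (hs : (Finset.univ.filter (fun i : Fin k => s i = true)).card ≤ 1) (b : Bool) :
    ∑ t, ktw P s b t =
      if b = true then
        (if ∃ i, ¬ P i ∧ s i = true then (k : ℝ)⁻¹ else ((Finset.univ.filter P).card : ℝ) / k)
      else (if ∃ i, ¬ P i ∧ s i = true then 0 else 1) := by
  unfold ktw
  rw [← Finset.sum_filter, Finset.sum_const, nsmul_eq_mul]
  cases b
  · have := kt_local_false P s
    simp only [Bool.false_eq_true, false_iff, if_false, mul_one]
    rw [this]; split_ifs <;> simp
  · have := kt_local_true P s hs
    simp only [true_iff, if_true]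
    rw [this]; split_ifs <;> simp [div_eq_mul_inv]

theorem kt_fiber {V : Type*} [Fintype V] [DecidableEq V]
    (μ : Conf V → ℝ) (k : ℕ)
    (S : Finset (V × Fin k)) (σ τ : Conf (V × Fin k)) (x : Conf V) :
    (if (∀ p ∈ Finset.univ \ S, τ p = σ p) ∧ kstar τ = x then ktrans μ k τ else 0)
      = μ x * ∏ v, ktw (fun i => (v, i) ∈ S) (fun i => σ (v, i)) (x v) (fun i => τ (v, i)) := by
  by_cases hall : ∀ v, (∀ i, ¬ (v, i) ∈ S → τ (v, i) = σ (v, i)) ∧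
      (Finset.univ.filter (fun i : Fin k => τ (v, i) = true)).card ≤ 1 ∧
      (x v = true ↔ ∃ i, τ (v, i) = true)
  · have hx : kstar τ = x := by
      funext v
      unfold kstar
      have := (hall v).2.2
      rw [Bool.eq_iff_iff]; simp [this]
    have hag : ∀ p ∈ Finset.univ \ S, τ p = σ p := by
      rintro ⟨v, i⟩ hp
      exact (hall v).1 i (by simpa using hp)
    rw [if_pos ⟨hag, hx⟩]
    · unfold ktrans
      rw [if_pos (fun v => (hall v).2.1), hx]
      congr 1
      rw [plusCount, plusSet, ← Finset.prod_const, Finset.prod_filter]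
      apply Finset.prod_congr rfl
      intro v _
      unfold ktw
      rw [if_pos (hall v)]
  · have h0 : ∏ v, ktw (fun i => (v, i) ∈ S) (fun i => σ (v, i)) (x v) (fun i => τ (v, i)) = 0 := by
      push Not at hall
      obtain ⟨v, hv⟩ := hall
      apply Finset.prod_eq_zero (Finset.mem_univ v)
      unfold ktw
      rw [if_neg]
      rintro ⟨h1, h2, h3⟩
      rcases hv h1 h2 with h | h
      · obtain ⟨i, hi⟩ := h3.1 h.1
        exact h.2 i hi
      · exact h.1 (h3.2 h.2)
    rw [h0, mul_zero]
    split_ifs with h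
    · obtain ⟨h1, rfl⟩ := h
      unfold ktrans
      rw [if_neg]
      intro h2
      apply hall
      intro v
      refine ⟨fun i hi => h1 _ (by simpa using hi), h2 v, by simp [kstar]⟩
    · rfl

theorem kt_sum {V : Type*} [Fintype V] [DecidableEq V]
    (μ : Conf V → ℝ) (k : ℕ)
    (S : Finset (V × Fin k)) (σ : Conf (V × Fin k)) 
    (hs : ∀ v, (Finset.univ.filter (fun i : Fin k => σ (v, i) = true)).card ≤ 1) (x : Conf V) :
    (∑ τ, if (∀ p ∈ Finset.univ \ S, τ p = σ p) ∧ kstar τ = x then ktrans μ k τ else 0)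
      = μ x * ∏ v, ∑ t, ktw (fun i => (v, i) ∈ S) (fun i => σ (v, i)) (x v) t := by
  simp only [kt_fiber]
  rw [← Finset.mul_sum, Fintype.prod_sum]
  congr 1
  exact Fintype.sum_equiv (Equiv.curry V (Fin k) Bool) _ _ (fun τ => rfl)

theorem kt_prod {V : Type*} [Fintype V] [DecidableEq V] (k : ℕ)
    (S : Finset (V × Fin k)) (σ : Conf (V × Fin k)) 
    (hs : ∀ v, (Finset.univ.filter (fun i : Fin k => σ (v, i) = true)).card ≤ 1) (x : Conf V)
    (F : Finset V) (hF : ∀ v, v ∈ F ↔ ∃ i : Fin k, (v, i) ∉ S ∧ σ (v, i) = true) :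
    ∏ v, ∑ t, ktw (fun i => (v, i) ∈ S) (fun i => σ (v, i)) (x v) t =
      (k : ℝ)⁻¹ ^ F.card * (if ∀ v ∈ F, x v = true then
        ∏ v, (if x v then (if v ∈ F then 1 else
          ((Finset.univ.filter (fun i : Fin k => (v, i) ∈ S)).card : ℝ) / (k : ℝ)) else 1) else 0) := by
  have e : ∀ v, ∑ t, ktw (fun i => (v, i) ∈ S) (fun i => σ (v, i)) (x v) t =
      (if v ∈ F then (k : ℝ)⁻¹ else 1) * ((if v ∈ F → x v = true then 1 else 0) * 
       (if x v then (if v ∈ F then 1 else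
          ((Finset.univ.filter (fun i : Fin k => (v, i) ∈ S)).card : ℝ) / (k : ℝ)) else 1)) := by
    intro v
    rw [ktw_sum _ _ (hs v)]
    simp only [← hF]
    by_cases h1 : v ∈ F <;> by_cases h2 : x v = true <;> simp [h1, h2]
    congr!
  simp only [e]
  rw [Finset.prod_mul_distrib, Finset.prod_mul_distrib]
  congr 1
  · simp [Finset.prod_ite]
  · by_cases h : ∀ v ∈ F, x v = true
    · rw [if_pos h, Finset.prod_eq_one, one_mul]
      intro v _; rw [if_pos (h v)]
    · rw [if_neg h]
      push Not at h
      obtain ⟨v, h1, h2⟩ := h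
      rw [Finset.prod_eq_zero (Finset.mem_univ v), zero_mul]
      rw [if_neg]; exact fun h => h2 (h h1)

/-- Conditional law of `kstar` -/
theorem kt_main {V : Type*} [Fintype V] [DecidableEq V]
    (μ : Conf V → ℝ) (hμ : IsDist μ) (k : ℕ) (hk : 1 ≤ k)
    (S : Finset (V × Fin k)) (σ : Conf (V × Fin k)) (hσ : 0 < ktrans μ k σ)
    (F : Finset V) (hF : ∀ v, v ∈ F ↔ ∃ i : Fin k, (v, i) ∉ S ∧ σ (v, i) = true)
    (g : Conf V → ℝ) :
    ∑ τ, condDist (ktrans μ k) (Finset.univ \ S) σ τ * g (kstar τ) =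
    ∑ x, condDist
          (magnetize μ (fun v =>
            if v ∈ F
            then 1
            else ((Finset.univ.filter (fun i : Fin k => (v, i) ∈ S)).card : ℝ) / (k : ℝ)))
          F (fun _ => true) x * g x := by
  have hs : ∀ v, (Finset.univ.filter (fun i : Fin k => σ (v, i) = true)).card ≤ 1 := by
    by_contra h
    unfold ktrans at hσ
    rw [if_neg h] at hσ
    exact lt_irrefl _ hσ
  have hk0 : (k : ℝ) ≠ 0 := by positivity
  set φ : V → ℝ := fun v => if v ∈ F then 1
            else ((Finset.univ.filter (fun i : Fin k => (v, i) ∈ S)).card : ℝ) / (k : ℝ) with hφ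
  set w : Conf V → ℝ := fun x => μ x * ∏ v, if x v then φ v else 1 with hw
  set c : ℝ := (k : ℝ)⁻¹ ^ F.card with hc
  have hc0 : c ≠ 0 := by positivity
  -- the unnormalised identity
  have key : ∀ g : Conf V → ℝ,
      (∑ τ, (if (∀ p ∈ Finset.univ \ S, τ p = σ p) then ktrans μ k τ else 0) * g (kstar τ)) =
      c * ∑ x, (if ∀ v ∈ F, x v = true then w x else 0) * g x := by
    intro g
    have h1 : ∀ τ : Conf (V × Fin k),
        (if (∀ p ∈ Finset.univ \ S, τ p = σ p) then ktrans μ k τ else 0) * g (kstar τ) =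
        ∑ x, (if (∀ p ∈ Finset.univ \ S, τ p = σ p) ∧ kstar τ = x
          then ktrans μ k τ else 0) * g x := by
      intro τ
      rw [Finset.sum_eq_single (kstar τ)]
      · simp
      · intro b _ hb
        rw [if_neg (fun h => hb h.2.symm), zero_mul]
      · simp
    simp only [h1]
    rw [Finset.sum_comm, Finset.mul_sum]
    apply Finset.sum_congr rfl
    intro x _
    rw [← Finset.sum_mul, kt_sum μ k S σ hs x, kt_prod k S σ hs x F hF]
    by_cases hx : ∀ v ∈ F, x v = true
    · rw [if_pos hx, if_pos hx]
      change μ x * (c * ∏ v, if x v then φ v else 1) * g x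
        = c * ((μ x * ∏ v, if x v then φ v else 1) * g x)
      ring
    · rw [if_neg hx, if_neg hx]; ring
  have hw0 : ∀ x, 0 ≤ w x := by
    intro x
    apply mul_nonneg (hμ.1 x)
    apply Finset.prod_nonneg
    intro v _
    simp only [hφ]
    split_ifs <;> positivity
  have hm : margin (ktrans μ k) (Finset.univ \ S) σ =
      c * ∑ x, (if ∀ v ∈ F, x v = true then w x else 0) := by
    have := key (fun _ => 1)
    simpa [margin] using this
  have hkt : ∀ τ, 0 ≤ ktrans μ k τ := by
    intro τ
    unfold ktrans
    split_ifs
    · exact mul_nonneg (hμ.1 _) (by positivity)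
    · exact le_rfl
  have hmpos : 0 < margin (ktrans μ k) (Finset.univ \ S) σ := by
    unfold margin
    apply Finset.sum_pos'
    · intro τ _; split_ifs; exacts [hkt τ, le_rfl]
    · exact ⟨σ, Finset.mem_univ _, by simpa using hσ⟩
  set M : ℝ := ∑ x, (if ∀ v ∈ F, x v = true then w x else 0) with hM
  have hM0 : M ≠ 0 := by
    intro h; rw [hm, h, mul_zero] at hmpos; exact lt_irrefl _ hmpos
  set Z : ℝ := ∑ x, w x with hZ
  have hMZ : M ≤ Z := by
    apply Finset.sum_le_sum
    intro x _; split_ifs; exacts [le_rfl, hw0 x]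
  have hMnn : 0 ≤ M := Finset.sum_nonneg (by
    intro x _; split_ifs; exacts [hw0 x, le_rfl])
  have hZ0 : Z ≠ 0 := by
    have : 0 < M := lt_of_le_of_ne hMnn (Ne.symm hM0)
    linarith
  have hmag : ∀ x, magnetize μ φ x = w x / Z := fun x => rfl
  have hmarg : margin (magnetize μ φ) F (fun _ => true) = M / Z := by
    unfold margin
    rw [hM, Finset.sum_div]
    apply Finset.sum_congr rfl
    intro x _
    rw [hmag]; split_ifs <;> simp
  have hl : ∀ τ, condDist (ktrans μ k) (Finset.univ \ S) σ τ * g (kstar τ) =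
      (c * M)⁻¹ * ((if (∀ p ∈ Finset.univ \ S, τ p = σ p) then ktrans μ k τ else 0) * g (kstar τ)) := by
    intro τ
    unfold condDist
    rw [hm]
    split_ifs
    · field_simp
    · simp
  have hr : ∀ x, condDist (magnetize μ φ) F (fun _ => true) x * g x =
      M⁻¹ * ((if ∀ v ∈ F, x v = true then w x else 0) * g x) := by
    intro x
    unfold condDist
    rw [hmarg, hmag]
    split_ifs
    · field_simp
    · simp
  simp only [hl, hr]
  rw [← Finset.mul_sum, ← Finset.mul_sum, key]
  field_simp

/-- Conditioned entropies of the `k`-transformed distribution coincide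
with entropies of a magnetized conditioned distribution:
`Ent_{μ_k^ρ}[f^k] = Ent_{μ^{(φ_ρ), 𝟙_{F(ρ)}}}[f]`. -/
theorem ktrans_cond_entropy {V : Type*} [Fintype V] [DecidableEq V]
    (μ : Conf V → ℝ) (hμ : IsDist μ) (k : ℕ) (hk : 1 ≤ k)
    (S : Finset (V × Fin k)) (σ : Conf (V × Fin k)) (hσ : 0 < ktrans μ k σ)
    (f : Conf V → ℝ) (hf : ∀ x, 0 ≤ f x) :
    entOf (condDist (ktrans μ k) (Finset.univ \ S) σ) (fun ρ => f (kstar ρ))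
      = entOf (condDist
          (magnetize μ (fun v =>
            if v ∈ Finset.univ.filter (fun w => ∃ i : Fin k, (w, i) ∉ S ∧ σ (w, i) = true)
            then 1
            else ((Finset.univ.filter (fun i : Fin k => (v, i) ∈ S)).card : ℝ) / (k : ℝ)))
          (Finset.univ.filter (fun w => ∃ i : Fin k, (w, i) ∉ S ∧ σ (w, i) = true))
          (fun _ => true)) f := by
  have h := kt_main μ hμ k hk S σ hσ
    (Finset.univ.filter (fun w => ∃ i : Fin k, (w, i) ∉ S ∧ σ (w, i) = true)) (by simp)
  unfold entOf
  rw [h f, h (fun x => f x * Real.log (f x))]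
end
end
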